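/- arXiv:2201.04770 — 3 statements merged into one kernel-verified Lean document; each statement's English description precedes it below -/
import Mathlib

section
/- Let D be a labeled ordered instance with a key function, let k ≥ 1 be at most the number of blocks of D, let ℓ1 ≠ ℓ2 be labels in Y, and let D* = Prune(D, ℓ2, ℓ1). Then there exists a primary-key repair I of D with C(ℓ2, I) ≥ C(ℓ1, I) if and only if there exists a primary-key repair I' of D* (with respect to the blocks of D*) with C(ℓ2, I') ≥ C(ℓ1, I'). -/
variable {T K Y : Type*}

/-- The k-neighborhood: the set of the `k` smallest elements of `I` under `<`. -/
def nbhd [LinearOrder T] (k : ℕ) (I : Finset T) : Finset T :=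
  I.filter fun t => (I.filter fun s => s < t).card < k

/-- `labCount L k ℓ I = C(ℓ, I)`: the number of elements of the `k`-neighborhood
of `I` carrying label `ℓ`. -/
def labCount [LinearOrder T] [DecidableEq Y] (L : T → Y) (k : ℕ) (ℓ : Y) (I : Finset T) : ℕ :=
  ((nbhd k I).filter fun t => L t = ℓ).card

/-- A primary-key repair of `D`: a subset of `D` containing exactly one tuple
from each nonempty block (tuples sharing a key). -/
def IsPKRepair [DecidableEq K] (key : T → K) (D I : Finset T) : Prop :=
  I ⊆ D ∧ ∀ t ∈ D, (I.filter fun s => key s = key t).card = 1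

/-- `Prune(D, ℓ2, ℓ1)`: remove every tuple `t` for which some tuple `t'` in the
same block satisfies (`t < t'` and `L t = ℓ1`) or (`t' < t` and `L t' = ℓ2`). -/
def Prune [LinearOrder T] [DecidableEq K] [DecidableEq Y]
    (key : T → K) (L : T → Y) (D : Finset T) (ℓ2 ℓ1 : Y) : Finset T :=
  D.filter fun t => ¬ ∃ t' ∈ D, key t' = key t ∧
    ((t < t' ∧ L t = ℓ1) ∨ (t' < t ∧ L t' = ℓ2))

section Neighborhood

variable [LinearOrder T]

lemma mem_nbhd {k : ℕ} {J : Finset T} {t : T} :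
    t ∈ nbhd k J ↔ t ∈ J ∧ (J.filter fun s => s < t).card < k := by
  simp [nbhd]

lemma card_filter_lt_mono (J : Finset T) {s t : T} (h : s ≤ t) :
    (J.filter fun x => x < s).card ≤ (J.filter fun x => x < t).card :=
  Finset.card_le_card (Finset.monotone_filter_right _ fun _ _ hx => lt_of_lt_of_le hx h)

lemma card_filter_lt_strictMono {J : Finset T} {s t : T} (hs : s ∈ J) (h : s < t) :
    (J.filter fun x => x < s).card < (J.filter fun x => x < t).card := by
  apply Finset.card_lt_card
  refine Finset.ssubset_iff_of_subset
    (Finset.monotone_filter_right _ fun _ _ hx => lt_trans hx h) |>.mpr ⟨s, ?_, ?_⟩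
  · simp [hs, h]
  · simp

lemma card_filter_lt_insert {J : Finset T} {s : T} (hs : s ∉ J) (t : T) :
    ((insert s J).filter fun x => x < t).card =
      (J.filter fun x => x < t).card + if s < t then 1 else 0 := by
  rw [Finset.filter_insert]
  split_ifs with h
  · rw [Finset.card_insert_of_notMem (by simp [hs])]
  · rfl

lemma nbhd_insert_of_card_le {J : Finset T} {s : T} (hs : s ∉ J) {k : ℕ}
    (h : (J.filter fun x => x < s).card ≤ k) :
    nbhd (k + 1) (insert s J) = insert s (nbhd k J) := by
  ext t
  simp only [mem_nbhd, card_filter_lt_insert hs, Finset.mem_insert]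
  rcases lt_trichotomy s t with hst | rfl | hst
  · simp [hst, hst.ne']
  · simp [hs]; omega
  · by_cases ht : t ∈ J
    · have := card_filter_lt_strictMono ht hst
      simp only [ht, hst.ne, not_lt_of_gt hst, if_false]
      simp only [or_true, true_and, false_or]
      omega
    · simp [ht, hst.ne]

lemma nbhd_insert_of_lt_card {J : Finset T} {s : T} (hs : s ∉ J) {k : ℕ}
    (h : k < (J.filter fun x => x < s).card) :
    nbhd (k + 1) (insert s J) = nbhd (k + 1) J := by
  ext t
  simp only [mem_nbhd, card_filter_lt_insert hs, Finset.mem_insert]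
  rcases lt_trichotomy s t with hst | rfl | hst
  · have := card_filter_lt_mono J hst.le
    simp only [hst, if_true, hst.ne', false_or]
    constructor <;> rintro ⟨-, h'⟩ <;> omega
  · simp [hs]; omega
  · simp [hst.ne, not_lt_of_gt hst]

lemma nbhd_succ (k : ℕ) (J : Finset T) :
    nbhd (k + 1) J = nbhd k J ∨ ∃ x ∉ nbhd k J, nbhd (k + 1) J = insert x (nbhd k J) := by
  by_cases hx : ∃ x ∈ J, (J.filter fun s => s < x).card = k
  · obtain ⟨x, hxJ, hx⟩ := hx
    refine Or.inr ⟨x, by simp [mem_nbhd, hx], ?_⟩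
    ext t
    simp only [mem_nbhd, Finset.mem_insert]
    constructor
    · rintro ⟨ht, hlt⟩
      rcases Nat.lt_succ_iff_lt_or_eq.mp hlt with h | h
      · exact Or.inr ⟨ht, h⟩
      · left
        rcases lt_trichotomy t x with h' | h' | h'
        · have := card_filter_lt_strictMono ht h'
          omega
        · exact h'
        · have := card_filter_lt_strictMono hxJ h'
          omega
    · rintro (rfl | ⟨ht, h⟩)
      · exact ⟨hxJ, by omega⟩
      · exact ⟨ht, by omega⟩
  · left
    ext t
    simp only [mem_nbhd]
    refine and_congr_right fun ht => ?_
    have : (J.filter fun s => s < t).card ≠ k := fun h => hx ⟨t, ht, h⟩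
    omega

lemma card_filter_label_insert [DecidableEq Y] (L : T → Y) (ℓ : Y) {S : Finset T} {x : T}
    (hx : x ∉ S) :
    ((insert x S).filter fun t => L t = ℓ).card =
      (S.filter fun t => L t = ℓ).card + if L x = ℓ then 1 else 0 := by
  rw [Finset.filter_insert]
  split_ifs with h
  · rw [Finset.card_insert_of_notMem (by simp [hx])]
  · rfl

lemma labCount_insert_of_card_le [DecidableEq Y] (L : T → Y) (ℓ : Y) {J : Finset T} {s : T}
    (hs : s ∉ J) {k : ℕ} (h : (J.filter fun x => x < s).card ≤ k) :
    labCount L (k + 1) ℓ (insert s J) = labCount L k ℓ J + if L s = ℓ then 1 else 0 := by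
  rw [labCount, nbhd_insert_of_card_le hs h, card_filter_label_insert, labCount]
  simp [mem_nbhd, hs]

lemma labCount_insert_of_lt_card [DecidableEq Y] (L : T → Y) (ℓ : Y) {J : Finset T} {s : T}
    (hs : s ∉ J) {k : ℕ} (h : k < (J.filter fun x => x < s).card) :
    labCount L (k + 1) ℓ (insert s J) = labCount L (k + 1) ℓ J := by
  rw [labCount, nbhd_insert_of_lt_card hs h, labCount]

lemma labCount_succ [DecidableEq Y] (L : T → Y) (k : ℕ) (J : Finset T) :
    (∀ ℓ, labCount L (k + 1) ℓ J = labCount L k ℓ J) ∨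
      ∃ x, ∀ ℓ, labCount L (k + 1) ℓ J = labCount L k ℓ J + if L x = ℓ then 1 else 0 := by
  rcases nbhd_succ k J with h | ⟨x, hx, h⟩
  · exact Or.inl fun ℓ => by simp only [labCount, h]
  · exact Or.inr ⟨x, fun ℓ => by rw [labCount, h, card_filter_label_insert L ℓ hx, labCount]⟩

/-- Replacing `t` by `t'` does not hurt `ℓ2` against `ℓ1` when an `ℓ1`-tuple moves away
or when an earlier `ℓ2`-tuple comes in. -/
lemma labCount_le_of_exchange [DecidableEq Y] (L : T → Y) {k : ℕ} (hk : 1 ≤ k) {ℓ1 ℓ2 : Y}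
    (hℓ : ℓ1 ≠ ℓ2) {J : Finset T} {t t' : T} (ht : t ∉ J) (ht' : t' ∉ J)
    (h : (t < t' ∧ L t = ℓ1) ∨ (t' < t ∧ L t' = ℓ2))
    (hle : labCount L k ℓ1 (insert t J) ≤ labCount L k ℓ2 (insert t J)) :
    labCount L k ℓ1 (insert t' J) ≤ labCount L k ℓ2 (insert t' J) := by
  obtain ⟨k, rfl⟩ := Nat.exists_eq_add_of_le' hk
  have hmono : t < t' ∧ (J.filter fun x => x < t).card ≤ (J.filter fun x => x < t').card ∨
      t' < t ∧ (J.filter fun x => x < t').card ≤ (J.filter fun x => x < t).card :=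
    h.imp (fun h => ⟨h.1, card_filter_lt_mono J h.1.le⟩)
      (fun h => ⟨h.1, card_filter_lt_mono J h.1.le⟩)
  rcases le_or_gt (J.filter fun x => x < t).card k with hc | hc <;>
  rcases le_or_gt (J.filter fun x => x < t').card k with hc' | hc' <;>
  rcases labCount_succ L k J with hs | ⟨x, hs⟩ <;>
  simp only [labCount_insert_of_card_le L _ ht, labCount_insert_of_card_le L _ ht',
    labCount_insert_of_lt_card L _ ht, labCount_insert_of_lt_card L _ ht', hc, hc', hs] at hle ⊢ <;>
  grind

end Neighborhood

lemma IsPKRepair.eq_of_key_eq [DecidableEq K] {key : T → K} {D I : Finset T} (hI : IsPKRepair key D I)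
    {s t : T} (hs : s ∈ I) (ht : t ∈ I) (h : key s = key t) : s = t :=
  Finset.card_le_one.mp (hI.2 t (hI.1 ht)).le s (by simp [hs, h]) t (by simp [ht])

section Repair

variable [LinearOrder T] [DecidableEq K] [DecidableEq Y]

lemma prune_subset (key : T → K) (L : T → Y) (D : Finset T) (ℓ2 ℓ1 : Y) :
    Prune key L D ℓ2 ℓ1 ⊆ D :=
  Finset.filter_subset _ _

lemma mem_prune {key : T → K} {L : T → Y} {D : Finset T} {ℓ2 ℓ1 : Y} {t : T} :
    t ∈ Prune key L D ℓ2 ℓ1 ↔ t ∈ D ∧ ∀ t' ∈ D, key t' = key t →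
      ¬ ((t < t' ∧ L t = ℓ1) ∨ (t' < t ∧ L t' = ℓ2)) := by
  simp only [Prune, Finset.mem_filter, not_exists, not_and]

lemma exists_mem_prune_of_notMem {key : T → K} {L : T → Y} {D : Finset T} {ℓ1 ℓ2 : Y}
    (hℓ : ℓ1 ≠ ℓ2) {t : T} (htD : t ∈ D) (ht : t ∉ Prune key L D ℓ2 ℓ1) :
    ∃ t' ∈ Prune key L D ℓ2 ℓ1, key t' = key t ∧
      ((t < t' ∧ L t = ℓ1) ∨ (t' < t ∧ L t' = ℓ2)) := by
  have hbad : ∃ s ∈ D, key s = key t ∧ ((t < s ∧ L t = ℓ1) ∨ (s < t ∧ L s = ℓ2)) := by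
    by_contra hcon
    exact ht (mem_prune.mpr ⟨htD, fun s hs hk h => hcon ⟨s, hs, hk, h⟩⟩)
  obtain ⟨s, hsD, hsk, hs⟩ := hbad
  by_cases hne : (D.filter fun x => key x = key t ∧ L x = ℓ2).Nonempty
  · obtain ⟨p, hp, hmin⟩ := Finset.exists_min_image _ id hne
    simp only [Finset.mem_filter, id, and_imp] at hp hmin
    refine ⟨p, mem_prune.mpr ⟨hp.1, fun r hr hrk => ?_⟩, hp.2.1, ?_⟩
    · have := hmin r hr
      grind
    · have := hmin s hsD hsk
      rcases lt_trichotomy t p with h | h | h <;> grind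
  · have hno : ∀ x ∈ D, key x = key t → L x ≠ ℓ2 := fun x hx hk hl =>
      hne ⟨x, by simp [hx, hk, hl]⟩
    obtain ⟨p, hp, hmax⟩ := Finset.exists_max_image (D.filter fun x => key x = key t) id
      ⟨t, by simp [htD]⟩
    simp only [Finset.mem_filter, id, and_imp] at hp hmax
    refine ⟨p, mem_prune.mpr ⟨hp.1, fun r hr hrk => ?_⟩, hp.2, ?_⟩
    · have := hmax r hr
      have := hno r hr
      grind
    · have := hmax s hsD hsk
      have := hno s hsD hsk
      grind

lemma exists_mem_prune_key_eq {key : T → K} {L : T → Y} {D : Finset T} {ℓ1 ℓ2 : Y}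
    (hℓ : ℓ1 ≠ ℓ2) {t : T} (htD : t ∈ D) :
    ∃ t' ∈ Prune key L D ℓ2 ℓ1, key t' = key t := by
  by_cases ht : t ∈ Prune key L D ℓ2 ℓ1
  · exact ⟨t, ht, rfl⟩
  · obtain ⟨t', h, hk, -⟩ := exists_mem_prune_of_notMem hℓ htD ht
    exact ⟨t', h, hk⟩

lemma IsPKRepair.exchange {key : T → K} {D I : Finset T} (hI : IsPKRepair key D I)
    {t t' : T} (ht : t ∈ I) (ht' : t' ∈ D) (h : key t' = key t) :
    IsPKRepair key D (insert t' (I.erase t)) := by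
  refine ⟨Finset.insert_subset ht' ((Finset.erase_subset _ _).trans hI.1), fun r hr => ?_⟩
  obtain ⟨a, ha⟩ := Finset.card_eq_one.mp (hI.2 r hr)
  rw [Finset.card_eq_one]
  have ha' : ∀ x, (x ∈ I ∧ key x = key r) ↔ x = a := fun x => by
    simpa using Finset.ext_iff.mp ha x
  refine ⟨if key t = key r then t' else a, ?_⟩
  ext x
  have hx := ha' x
  have hat := ha' t
  simp only [Finset.mem_filter, Finset.mem_insert, Finset.mem_erase, Finset.mem_singleton]
  split_ifs <;> grind

lemma exists_repair_subset_prune {key : T → K} {L : T → Y} {D : Finset T} {k : ℕ} (hk : 1 ≤ k)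
    {ℓ1 ℓ2 : Y} (hℓ : ℓ1 ≠ ℓ2) {I : Finset T} (hI : IsPKRepair key D I)
    (hle : labCount L k ℓ1 I ≤ labCount L k ℓ2 I) :
    ∃ I' ⊆ Prune key L D ℓ2 ℓ1, IsPKRepair key D I' ∧
      labCount L k ℓ1 I' ≤ labCount L k ℓ2 I' := by
  induction hn : (I \ Prune key L D ℓ2 ℓ1).card using Nat.strong_induction_on generalizing I with
  | _ n ih =>
    by_cases hsub : I ⊆ Prune key L D ℓ2 ℓ1
    · exact ⟨I, hsub, hI, hle⟩
    obtain ⟨t, htI, ht⟩ := Finset.not_subset.mp hsub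
    obtain ⟨t', ht', hkey, h⟩ := exists_mem_prune_of_notMem hℓ (hI.1 htI) ht
    have ht'J : t' ∉ I.erase t := fun hmem =>
      (Finset.mem_erase.mp hmem).1 (hI.eq_of_key_eq (Finset.mem_erase.mp hmem).2 htI hkey)
    refine ih _ ?_ (hI.exchange htI (prune_subset _ _ _ _ _ ht') hkey)
      (labCount_le_of_exchange L hk hℓ (Finset.notMem_erase t I) ht'J h
        (by rwa [Finset.insert_erase htI])) rfl
    rw [← hn]
    refine Finset.card_lt_card (Finset.ssubset_iff_of_subset (fun x hx => ?_) |>.mpr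
      ⟨t, Finset.mem_sdiff.mpr ⟨htI, ht⟩, ?_⟩) <;> grind

end Repair

theorem stmt1 [LinearOrder T] [DecidableEq K] [DecidableEq Y]
    (D : Finset T) (key : T → K) (L : T → Y) (k : ℕ) (hk : 1 ≤ k)
    (hkblocks : k ≤ (D.image key).card)
    (ℓ1 ℓ2 : Y) (hℓ : ℓ1 ≠ ℓ2) :
    (∃ I : Finset T, IsPKRepair key D I ∧ labCount L k ℓ1 I ≤ labCount L k ℓ2 I) ↔
      (∃ I' : Finset T, IsPKRepair key (Prune key L D ℓ2 ℓ1) I' ∧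
        labCount L k ℓ1 I' ≤ labCount L k ℓ2 I') := by
  constructor
  · rintro ⟨I, hI, hle⟩
    obtain ⟨I', hsub, hI', hle'⟩ := exists_repair_subset_prune hk hℓ hI hle
    exact ⟨I', ⟨hsub, fun t ht => hI'.2 t (prune_subset key L D ℓ2 ℓ1 ht)⟩, hle'⟩
  · rintro ⟨I, hI, hle⟩
    refine ⟨I, ⟨hI.1.trans (prune_subset key L D ℓ2 ℓ1), fun t ht => ?_⟩, hle⟩
    obtain ⟨t', ht', hkey⟩ := exists_mem_prune_key_eq (key := key) (L := L) hℓ ht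
    rw [← hkey]
    exact hI.2 t' ht'
end

section
/- Let Σ be an FD set over {1,…,d} containing a consensus FD ∅ → {A} for some attribute A, and let D ⊆ dom^d be a finite nonempty instance. Then a subset I ⊆ D is a repair of D w.r.t. Σ if and only if there exists a value a ∈ π_A(D) such that I ⊆ σ_{A=a}(D) and I is a repair of σ_{A=a}(D) w.r.t. Σ − A. -/
/-- A set `I` of tuples satisfies the FD `fd = (X, B)` if any two tuples of `I`
agreeing on every attribute of `X` also agree on every attribute of `B`. -/
def SatFD {d : ℕ} {dom : Type*} (I : Finset (Fin d → dom))
    (fd : Set (Fin d) × Set (Fin d)) : Prop :=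
  ∀ s ∈ I, ∀ t ∈ I, (∀ a ∈ fd.1, s a = t a) → ∀ b ∈ fd.2, s b = t b

/-- `I` satisfies every FD of the FD set `FDs`. -/
def SatFDs {d : ℕ} {dom : Type*} (I : Finset (Fin d → dom))
    (FDs : Set (Set (Fin d) × Set (Fin d))) : Prop :=
  ∀ fd ∈ FDs, SatFD I fd

/-- `I` is a repair of `D` w.r.t. `FDs`: a subset of `D` satisfying `FDs` that is
maximal under inclusion among the subsets of `D` satisfying `FDs`. -/
def IsFDRepair {d : ℕ} {dom : Type*} (FDs : Set (Set (Fin d) × Set (Fin d)))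
    (D I : Finset (Fin d → dom)) : Prop :=
  I ⊆ D ∧ SatFDs I FDs ∧ ∀ J : Finset (Fin d → dom), I ⊆ J → J ⊆ D → SatFDs J FDs → J = I

/-- `FDs − A`: remove attribute `A` from the left- and right-hand side of every FD. -/
def removeAttr {d : ℕ} (A : Fin d) (FDs : Set (Set (Fin d) × Set (Fin d))) :
    Set (Set (Fin d) × Set (Fin d)) :=
  (fun fd => (fd.1 \ {A}, fd.2 \ {A})) '' FDs

/-- An FD set containing `∅ → {A}` forces `A` to be constant. -/
lemma SatFDs.eq_of_consensus {d : ℕ} {dom : Type*} {FDs : Set (Set (Fin d) × Set (Fin d))}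
    {A : Fin d} (hA : ((∅ : Set (Fin d)), ({A} : Set (Fin d))) ∈ FDs)
    {J : Finset (Fin d → dom)} (hJ : SatFDs J FDs) {s t : Fin d → dom}
    (hs : s ∈ J) (ht : t ∈ J) : s A = t A :=
  hJ _ hA s hs t ht (fun _ h => absurd h (Set.notMem_empty _)) A rfl

/-- On instances where `A` is constant, removing `A` from the FDs changes nothing. -/
lemma satFDs_removeAttr_iff {d : ℕ} {dom : Type*} (FDs : Set (Set (Fin d) × Set (Fin d)))
    {A : Fin d} {J : Finset (Fin d → dom)} {a : dom} (hJ : ∀ t ∈ J, t A = a) :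
    SatFDs J (removeAttr A FDs) ↔ SatFDs J FDs := by
  have hA : ∀ s ∈ J, ∀ t ∈ J, s A = t A := fun s hs t ht => (hJ s hs).trans (hJ t ht).symm
  simp only [SatFDs, removeAttr, Set.forall_mem_image]
  refine forall₂_congr fun fd _ => forall₄_congr fun s hs t ht => ?_
  have key : ∀ X : Set (Fin d), (∀ x ∈ X \ {A}, s x = t x) ↔ ∀ x ∈ X, s x = t x := by
    refine fun X => ⟨fun h x hx => ?_, fun h x hx => h x hx.1⟩
    by_cases hxA : x = A
    · exact hxA ▸ hA s hs t ht
    · exact h x ⟨hx, hxA⟩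
  exact imp_congr (key _) (key _)

lemma satFDs_singleton {d : ℕ} {dom : Type*} (FDs : Set (Set (Fin d) × Set (Fin d)))
    (t : Fin d → dom) : SatFDs {t} FDs := by
  intro fd _ s hs u hu _ b _
  rw [Finset.mem_singleton.1 hs, Finset.mem_singleton.1 hu]

lemma IsFDRepair.nonempty {d : ℕ} {dom : Type*} {FDs : Set (Set (Fin d) × Set (Fin d))}
    {D I : Finset (Fin d → dom)} (h : IsFDRepair FDs D I) (hD : D.Nonempty) : I.Nonempty := by
  obtain ⟨t, ht⟩ := hD
  rw [Finset.nonempty_iff_ne_empty]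
  rintro rfl
  exact Finset.singleton_ne_empty t
    (h.2.2 {t} (Finset.empty_subset _) (Finset.singleton_subset_iff.2 ht)
      (satFDs_singleton FDs t))

theorem stmt10 {d : ℕ} {dom : Type*} [DecidableEq dom]
    (FDs : Set (Set (Fin d) × Set (Fin d))) (A : Fin d)
    -- FDs contains the consensus FD ∅ → {A}
    (hA : ((∅ : Set (Fin d)), ({A} : Set (Fin d))) ∈ FDs)
    (D : Finset (Fin d → dom)) (hD : D.Nonempty)
    (I : Finset (Fin d → dom)) (hI : I ⊆ D) :
    IsFDRepair FDs D I ↔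
      ∃ a ∈ D.image (fun t => t A),
        I ⊆ D.filter (fun t => t A = a) ∧
        IsFDRepair (removeAttr A FDs) (D.filter (fun t => t A = a)) I := by
  constructor
  · intro h
    obtain ⟨t, ht⟩ := h.nonempty hD
    have hc : ∀ s ∈ I, s A = t A := fun s hs => h.2.1.eq_of_consensus hA hs ht
    have hsub : I ⊆ D.filter (fun s => s A = t A) :=
      fun s hs => Finset.mem_filter.2 ⟨hI hs, hc s hs⟩
    refine ⟨t A, Finset.mem_image_of_mem _ (hI ht), hsub, hsub,
      (satFDs_removeAttr_iff FDs hc).2 h.2.1, fun J hIJ hJ hsat => ?_⟩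
    exact h.2.2 J hIJ (hJ.trans (Finset.filter_subset _ _))
      ((satFDs_removeAttr_iff FDs fun s hs => (Finset.mem_filter.1 (hJ hs)).2).1 hsat)
  · rintro ⟨a, ha, hsub, h⟩
    obtain ⟨u, hu, hua⟩ := Finset.mem_image.1 ha
    obtain ⟨t, ht⟩ := h.nonempty ⟨u, Finset.mem_filter.2 ⟨hu, hua⟩⟩
    have hc : ∀ s ∈ I, s A = a := fun s hs => (Finset.mem_filter.1 (hsub hs)).2
    refine ⟨hI, (satFDs_removeAttr_iff FDs hc).1 h.2.1, fun J hIJ hJ hsat => ?_⟩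
    have hJc : ∀ s ∈ J, s A = a :=
      fun s hs => (hsat.eq_of_consensus hA hs (hIJ ht)).trans (hc t ht)
    exact h.2.2 J hIJ (fun s hs => Finset.mem_filter.2 ⟨hJ hs, hJc s hs⟩)
      ((satFDs_removeAttr_iff FDs hJc).2 hsat)
end

section
/- Let D be a labeled ordered instance with a key function such that all tuples within the same block have the same label, let k ≥ 1 be at most the number of blocks of D, and let ℓ1 ≠ ℓ2 be labels in Y. Then there exists a primary-key repair I of D with C(ℓ2, I) ≥ C(ℓ1, I) if and only if there exists a primary-key repair I' of D with C(ℓ2, I') ≥ C(ℓ1, I') such that from each block, I' contains either the <-minimal or the <-maximal tuple of that block. -/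
variable {T K Y : Type*}

lemma nbhd_subset [LinearOrder T] (k : ℕ) (I : Finset T) : nbhd k I ⊆ I :=
  Finset.filter_subset _ _

lemma mem_nbhd_of_le [LinearOrder T] {k : ℕ} {I : Finset T} {s t : T} (hs : s ∈ I)
    (hst : s ≤ t) (ht : t ∈ nbhd k I) : s ∈ nbhd k I := by
  refine Finset.mem_filter.2 ⟨hs, lt_of_le_of_lt (Finset.card_le_card ?_)
    (Finset.mem_filter.1 ht).2⟩
  exact Finset.monotone_filter_right I fun x _ hx => lt_of_lt_of_le hx hst

lemma card_nbhd_le [LinearOrder T] (k : ℕ) (I : Finset T) : (nbhd k I).card ≤ k := by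
  rcases (nbhd k I).eq_empty_or_nonempty with h | h
  · simp [h]
  · obtain ⟨t, ht, hmax⟩ := Finset.exists_max_image (nbhd k I) id h
    have hsub : (nbhd k I).erase t ⊆ I.filter fun s => s < t := by
      intro s hs
      obtain ⟨hne, hs⟩ := Finset.mem_erase.1 hs
      exact Finset.mem_filter.2 ⟨nbhd_subset k I hs, lt_of_le_of_ne (hmax s hs) hne⟩
    have hle := Finset.card_le_card hsub
    have hlt := (Finset.mem_filter.1 ht).2
    have herase := Finset.card_erase_add_one ht
    omega

lemma le_card_nbhd_of_notMem [LinearOrder T] {k : ℕ} {I : Finset T} {t : T} (ht : t ∈ I)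
    (htN : t ∉ nbhd k I) : k ≤ (nbhd k I).card := by
  obtain ⟨u, hu, hmin⟩ := Finset.exists_min_image (I \ nbhd k I) id
    ⟨t, Finset.mem_sdiff.2 ⟨ht, htN⟩⟩
  obtain ⟨huI, huN⟩ := Finset.mem_sdiff.1 hu
  have hcard : k ≤ (I.filter fun s => s < u).card := by
    by_contra h
    exact huN (Finset.mem_filter.2 ⟨huI, not_le.1 h⟩)
  refine hcard.trans (Finset.card_le_card fun s hs => ?_)
  obtain ⟨hsI, hsu⟩ := Finset.mem_filter.1 hs
  by_contra hsN
  exact absurd (hmin s (Finset.mem_sdiff.2 ⟨hsI, hsN⟩)) (not_le.2 hsu)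

/-- Moving the elements of the neighborhood down and all other elements up does not change
which elements form the neighborhood. -/
lemma nbhd_image [LinearOrder T] {k : ℕ} {I : Finset T} {f : T → T}
    (hinj : Set.InjOn f I) (hdown : ∀ t ∈ nbhd k I, f t ≤ t)
    (hup : ∀ t ∈ I, t ∉ nbhd k I → t ≤ f t) :
    nbhd k (I.image f) = (nbhd k I).image f := by
  have hlt : ∀ s ∈ nbhd k I, ∀ t ∈ I, t ∉ nbhd k I → f s < f t := fun s hs t ht htN =>
    (hdown s hs).trans_lt <| lt_of_lt_of_le
      (not_le.1 fun h => htN (mem_nbhd_of_le ht h hs)) (hup t ht htN)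
  have hcard : ((nbhd k I).image f).card = (nbhd k I).card :=
    Finset.card_image_of_injOn (hinj.mono (nbhd_subset k I))
  ext x
  constructor
  · intro hx
    obtain ⟨hxI, hxk⟩ := Finset.mem_filter.1 hx
    obtain ⟨t, ht, rfl⟩ := Finset.mem_image.1 hxI
    refine Finset.mem_image_of_mem f ?_
    by_contra htN
    have hsub : (nbhd k I).image f ⊆ (I.image f).filter fun s => s < f t := by
      intro y hy
      obtain ⟨s, hs, rfl⟩ := Finset.mem_image.1 hy
      exact Finset.mem_filter.2
        ⟨Finset.mem_image_of_mem f (nbhd_subset k I hs), hlt s hs t ht htN⟩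
    have hle := Finset.card_le_card hsub
    have hk := le_card_nbhd_of_notMem ht htN
    omega
  · intro hx
    obtain ⟨t, ht, rfl⟩ := Finset.mem_image.1 hx
    refine Finset.mem_filter.2 ⟨Finset.mem_image_of_mem f (nbhd_subset k I ht), ?_⟩
    have hsub : ((I.image f).filter fun s => s < f t) ⊂ (nbhd k I).image f := by
      refine (Finset.ssubset_iff_of_subset fun y hy => ?_).2 ⟨f t, hx, by simp⟩
      obtain ⟨hy, hyt⟩ := Finset.mem_filter.1 hy
      obtain ⟨s, hs, rfl⟩ := Finset.mem_image.1 hy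
      refine Finset.mem_image_of_mem f ?_
      by_contra hsN
      exact lt_asymm hyt (hlt t ht s hs hsN)
    have hcl := Finset.card_lt_card hsub
    have hk := card_nbhd_le k I
    omega

lemma labCount_image [LinearOrder T] [DecidableEq Y] {L : T → Y} {k : ℕ} {I : Finset T}
    {f : T → T} (hinj : Set.InjOn f I) (hdown : ∀ t ∈ nbhd k I, f t ≤ t)
    (hup : ∀ t ∈ I, t ∉ nbhd k I → t ≤ f t) (hL : ∀ t ∈ I, L (f t) = L t) (ℓ : Y) :
    labCount L k ℓ (I.image f) = labCount L k ℓ I := by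
  unfold labCount
  rw [nbhd_image hinj hdown hup, Finset.filter_image, Finset.card_image_of_injOn]
  · congr 1
    exact Finset.filter_congr fun t ht => by rw [hL t (nbhd_subset k I ht)]
  · exact hinj.mono fun t ht => nbhd_subset k I (Finset.mem_filter.1 ht).1

lemma IsPKRepair.injOn_key [DecidableEq K] {key : T → K} {D I : Finset T}
    (h : IsPKRepair key D I) : Set.InjOn key I := fun s hs t ht hst =>
  Finset.card_le_one.1 (h.2 t (h.1 ht)).le s (Finset.mem_filter.2 ⟨hs, hst⟩) t
    (Finset.mem_filter.2 ⟨ht, rfl⟩)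

lemma IsPKRepair.image [DecidableEq T] [DecidableEq K] {key : T → K} {D I : Finset T}
    (h : IsPKRepair key D I) {f : T → T} (hfD : ∀ t ∈ I, f t ∈ D)
    (hkey : ∀ t ∈ I, key (f t) = key t) : IsPKRepair key D (I.image f) := by
  have hinj : Set.InjOn f I := fun s hs t ht hst =>
    h.injOn_key hs ht (by rw [← hkey s hs, ← hkey t ht, hst])
  refine ⟨Finset.image_subset_iff.2 hfD, fun t ht => ?_⟩
  rw [Finset.filter_image, Finset.card_image_of_injOn
    (hinj.mono fun s hs => (Finset.mem_filter.1 hs).1), ← h.2 t ht]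
  congr 1
  exact Finset.filter_congr fun s hs => by rw [hkey s hs]

theorem stmt17 [LinearOrder T] [DecidableEq K] [DecidableEq Y]
    (D : Finset T) (key : T → K) (L : T → Y)
    -- all tuples in the same block have the same label
    (hblock : ∀ t ∈ D, ∀ t' ∈ D, key t = key t' → L t = L t')
    (k : ℕ) (hk : 1 ≤ k) (hkblocks : k ≤ (D.image key).card)
    (ℓ1 ℓ2 : Y) (hℓ : ℓ1 ≠ ℓ2) :
    (∃ I : Finset T, IsPKRepair key D I ∧ labCount L k ℓ1 I ≤ labCount L k ℓ2 I) ↔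
      (∃ I' : Finset T, IsPKRepair key D I' ∧ labCount L k ℓ1 I' ≤ labCount L k ℓ2 I' ∧
        -- I' contains from each block either its <-minimal or its <-maximal tuple
        ∀ t ∈ I', (∀ s ∈ D, key s = key t → t ≤ s) ∨ (∀ s ∈ D, key s = key t → s ≤ t)) := by
  constructor
  · rintro ⟨I, hI, hle⟩
    have hmin : ∀ t ∈ D, ∃ m ∈ D, key m = key t ∧ ∀ s ∈ D, key s = key t → m ≤ s := by
      intro t ht
      obtain ⟨m, hm, h⟩ := Finset.exists_min_image (D.filter fun s => key s = key t) id
        ⟨t, Finset.mem_filter.2 ⟨ht, rfl⟩⟩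
      obtain ⟨hmD, hmt⟩ := Finset.mem_filter.1 hm
      exact ⟨m, hmD, hmt, fun s hs hst => h s (Finset.mem_filter.2 ⟨hs, hst⟩)⟩
    have hmax : ∀ t ∈ D, ∃ m ∈ D, key m = key t ∧ ∀ s ∈ D, key s = key t → s ≤ m := by
      intro t ht
      obtain ⟨m, hm, h⟩ := Finset.exists_max_image (D.filter fun s => key s = key t) id
        ⟨t, Finset.mem_filter.2 ⟨ht, rfl⟩⟩
      obtain ⟨hmD, hmt⟩ := Finset.mem_filter.1 hm
      exact ⟨m, hmD, hmt, fun s hs hst => h s (Finset.mem_filter.2 ⟨hs, hst⟩)⟩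
    have hex : ∀ t, ∃ m, t ∈ I → m ∈ D ∧ key m = key t ∧
        (t ∈ nbhd k I → ∀ s ∈ D, key s = key t → m ≤ s) ∧
        (t ∉ nbhd k I → ∀ s ∈ D, key s = key t → s ≤ m) := by
      intro t
      by_cases ht : t ∈ I
      · by_cases htN : t ∈ nbhd k I
        · obtain ⟨m, hmD, hmt, h⟩ := hmin t (hI.1 ht)
          exact ⟨m, fun _ => ⟨hmD, hmt, fun _ => h, fun hn => absurd htN hn⟩⟩
        · obtain ⟨m, hmD, hmt, h⟩ := hmax t (hI.1 ht)
          exact ⟨m, fun _ => ⟨hmD, hmt, fun hn => absurd hn htN, fun _ => h⟩⟩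
      · exact ⟨t, fun h => absurd h ht⟩
    choose f hf using hex
    have hinj : Set.InjOn f I := fun s hs t ht hst =>
      hI.injOn_key hs ht (by rw [← (hf s hs).2.1, ← (hf t ht).2.1, hst])
    have hdown : ∀ t ∈ nbhd k I, f t ≤ t := fun t ht =>
      have htI := nbhd_subset k I ht
      (hf t htI).2.2.1 ht t (hI.1 htI) rfl
    have hup : ∀ t ∈ I, t ∉ nbhd k I → t ≤ f t := fun t ht htN =>
      (hf t ht).2.2.2 htN t (hI.1 ht) rfl
    have hL : ∀ t ∈ I, L (f t) = L t := fun t ht =>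
      hblock _ (hf t ht).1 t (hI.1 ht) (hf t ht).2.1
    refine ⟨I.image f, hI.image (fun t ht => (hf t ht).1) (fun t ht => (hf t ht).2.1), ?_, ?_⟩
    · rwa [labCount_image hinj hdown hup hL, labCount_image hinj hdown hup hL]
    · intro x hx
      obtain ⟨t, ht, rfl⟩ := Finset.mem_image.1 hx
      rw [(hf t ht).2.1]
      by_cases htN : t ∈ nbhd k I
      · exact Or.inl ((hf t ht).2.2.1 htN)
      · exact Or.inr ((hf t ht).2.2.2 htN)
  · rintro ⟨I, hI, hle, -⟩
    exact ⟨I, hI, hle⟩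
end
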